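/- Let n ≥ 1 and let A be an n×n matrix over ℕ with entries in {0,1}. Define the layered matrix B, indexed by pairs (i,l) with i an index in {1,...,n} and l a layer in {0,1,...,n}, by: B((i,l),(j,m)) = A(i,j) if m = l+1 and l ≤ n−2; B((i,l),(j,m)) = 1 if j = i, m = n and l ≤ n−1; and B((i,l),(j,m)) = 0 otherwise. Then B^{n+1} = 0, and for all i, j: Σ_{k=0}^{n} (B^k)((i,0),(j,n)) = Σ_{k=0}^{n−1} (A^k)(i,j). -/

import Mathlib

/-- The adjacency matrix of the layered graph `lay(G)` of a directed graph `G` on `n`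
vertices with adjacency matrix `A`: vertices are pairs `(i, l)` with `l ∈ {0, …, n}`;
there is an edge `(i, l) → (j, l+1)` (weight `A i j`) whenever `l ≤ n − 2`
(i.e. `l + 2 ≤ n`), and an edge `(i, l) → (i, n)` whenever `l ≤ n − 1`
(i.e. `l + 1 ≤ n`); all other entries are `0`. -/
def layered (n : ℕ) (A : Matrix (Fin n) (Fin n) ℕ) :
    Matrix (Fin n × Fin (n + 1)) (Fin n × Fin (n + 1)) ℕ :=
  fun p q =>
    (if (q.2 : ℕ) = (p.2 : ℕ) + 1 ∧ (p.2 : ℕ) + 2 ≤ n then A p.1 q.1 else 0) +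
    (if q.1 = p.1 ∧ (q.2 : ℕ) = n ∧ (p.2 : ℕ) + 1 ≤ n then 1 else 0)

theorem layered_last_left (n : ℕ) (A : Matrix (Fin n) (Fin n) ℕ) (i : Fin n)
    (q : Fin n × Fin (n + 1)) : layered n A (i, Fin.last n) q = 0 := by
  simp [layered]

theorem layered_castSucc_castSucc (n : ℕ) (A : Matrix (Fin n) (Fin n) ℕ) (i j l m : Fin n) :
    layered n A (i, l.castSucc) (j, m.castSucc) = if (m : ℕ) = l + 1 then A i j else 0 := by
  have hm := m.isLt
  have h : ((m : ℕ) = l + 1 ∧ (l : ℕ) + 2 ≤ n) ↔ (m : ℕ) = l + 1 := by omega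
  simp [layered, h, hm.ne]

theorem layered_castSucc_last (n : ℕ) (A : Matrix (Fin n) (Fin n) ℕ) (i j l : Fin n) :
    layered n A (i, l.castSucc) (j, Fin.last n) = if j = i then 1 else 0 := by
  have h : ¬(n = (l : ℕ) + 1 ∧ (l : ℕ) + 2 ≤ n) := by omega
  have hl : (l : ℕ) + 1 ≤ n := l.isLt
  simp [layered, h, hl]

theorem layered_pow_succ_apply (n : ℕ) (A : Matrix (Fin n) (Fin n) ℕ) (k : ℕ)
    (p q : Fin n × Fin (n + 1)) :
    (layered n A ^ (k + 1)) p q =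
      ∑ i, ∑ l : Fin n, (layered n A ^ k) p (i, l.castSucc) * layered n A (i, l.castSucc) q := by
  simp [pow_succ, Matrix.mul_apply, Fintype.sum_prod_type, Fin.sum_univ_castSucc,
    layered_last_left]

/-- A walk of length `k` starting in layer `0` and ending below the last layer is a walk of
length `k` in the original graph, and ends in layer `k`. -/
theorem layered_pow_apply_castSucc (n : ℕ) (A : Matrix (Fin n) (Fin n) ℕ) (k : ℕ)
    (i j m : Fin n) :
    (layered n A ^ k) (i, 0) (j, m.castSucc) = if (m : ℕ) = k then (A ^ k) i j else 0 := by
  induction k generalizing j m with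
  | zero =>
    simp only [pow_zero, Matrix.one_apply, Prod.mk.injEq, Fin.ext_iff, Fin.val_zero,
      Fin.val_castSucc]
    grind
  | succ k ih =>
    simp only [layered_pow_succ_apply, ih, layered_castSucc_castSucc]
    split_ifs with h
    · rw [pow_succ, Matrix.mul_apply]
      refine Finset.sum_congr rfl fun x _ => ?_
      rw [Finset.sum_eq_single (⟨k, by omega⟩ : Fin n)]
      · simp [h]
      · intro b _ hb
        rw [if_neg (fun hk => hb (Fin.ext hk)), zero_mul]
      · simp
    · refine Finset.sum_eq_zero fun x _ => Finset.sum_eq_zero fun l _ => ?_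
      by_cases hl : (l : ℕ) = k
      · simp [hl, h]
      · simp [hl]

theorem layered_pow_succ_apply_last (n : ℕ) (A : Matrix (Fin n) (Fin n) ℕ) {k : ℕ} (hk : k < n)
    (i j : Fin n) :
    (layered n A ^ (k + 1)) (i, 0) (j, Fin.last n) = (A ^ k) i j := by
  simp only [layered_pow_succ_apply, layered_pow_apply_castSucc, layered_castSucc_last]
  rw [Finset.sum_eq_single j, Finset.sum_eq_single (⟨k, hk⟩ : Fin n)]
  · simp
  · intro b _ hb
    rw [if_neg (fun h => hb (Fin.ext h)), zero_mul]
  · simp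
  · intro b _ hb
    simp [hb.symm]
  · simp

theorem layered_pow_apply_eq_zero (n : ℕ) (A : Matrix (Fin n) (Fin n) ℕ) (k : ℕ)
    (p q : Fin n × Fin (n + 1)) (h : (q.2 : ℕ) < p.2 + k) : (layered n A ^ k) p q = 0 := by
  induction k generalizing q with
  | zero =>
    rw [pow_zero, Matrix.one_apply_ne]
    rintro rfl
    omega
  | succ k ih =>
    rw [pow_succ, Matrix.mul_apply]
    refine Finset.sum_eq_zero fun r _ => ?_
    by_cases hr : (r.2 : ℕ) < p.2 + k
    · rw [ih r hr, zero_mul]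
    · have h₁ : ¬((q.2 : ℕ) = r.2 + 1 ∧ (r.2 : ℕ) + 2 ≤ n) := by omega
      have h₂ : ¬(q.1 = r.1 ∧ (q.2 : ℕ) = n ∧ (r.2 : ℕ) + 1 ≤ n) := by omega
      simp only [layered, if_neg h₁, if_neg h₂, add_zero, mul_zero]

/-- Let `n ≥ 1` and `A` an `n × n` matrix over `ℕ` with entries in `{0,1}`,
and let `B` be the layered matrix of `A`. Then `B^{n+1} = 0` and for all `i, j` the total
number of walks in the layered graph from `(i, 0)` to `(j, n)` equals the number of walks
in `G` from `i` to `j` of length less than `n`: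
`∑_{k=0}^{n} (B^k) (i,0) (j,n) = ∑_{k=0}^{n-1} (A^k) i j`. -/
theorem stmt_13 (n : ℕ) (hn : 1 ≤ n) (A : Matrix (Fin n) (Fin n) ℕ)
    (hA : ∀ i j, A i j = 0 ∨ A i j = 1) :
    layered n A ^ (n + 1) = 0 ∧
    ∀ i j : Fin n,
      ∑ k ∈ Finset.range (n + 1), (layered n A ^ k) (i, 0) (j, Fin.last n)
        = ∑ k ∈ Finset.range n, (A ^ k) i j := by
  refine ⟨?_, fun i j => ?_⟩
  · ext p q
    exact layered_pow_apply_eq_zero n A (n + 1) p q (by omega)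
  · have h₀ : (layered n A ^ 0) (i, 0) (j, Fin.last n) = 0 := by
      rw [pow_zero, Matrix.one_apply_ne]
      intro h
      have := congrArg (fun p => (p.2 : ℕ)) h
      simp only [Fin.val_zero, Fin.val_last] at this
      omega
    rw [Finset.sum_range_succ', h₀, add_zero]
    exact Finset.sum_congr rfl fun k hk =>
      layered_pow_succ_apply_last n A (Finset.mem_range.mp hk) i j
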